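/- Let L ⊆ V^P be an isotropic subspace without zero factors. If every nontrivial qubit of P is protected, then the group Ā(L) = A(L)/Z(L) is finite. -/

import Mathlib

/- Common framework: binary stabilizer codes, local unitary/SO(3) automorphism groups. -/

noncomputable section
open scoped Matrix Real ComplexConjugate
open scoped Classical

namespace Stab

/-- The one-qubit phase space `V = 𝔽₂ ⊕ 𝔽₂`, with first coordinate the `z`-component
and second coordinate the `x`-component. -/
abbrev V : Type := ZMod 2 × ZMod 2

/-- The symplectic form on `V`. -/
def omegaV (u v : V) : ZMod 2 := u.1 * v.2 + u.2 * v.1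

/-- The phase space `V^P` over a set of qubits `P`. -/
abbrev QV (P : Type) := P → V

variable {P : Type} [Fintype P] [DecidableEq P]

/-- The direct-sum symplectic form on `V^P`. -/
def omega (u v : QV P) : ZMod 2 := ∑ p, omegaV (u p) (v p)

/-- A subspace `L ⊆ V^P` is isotropic if `ω` vanishes identically on `L × L`. -/
def Isotropic (L : Submodule (ZMod 2) (QV P)) : Prop := ∀ u ∈ L, ∀ v ∈ L, omega u v = 0

/-- Support of a vector of `V^P`. -/
def supp (v : QV P) : Set P := {p | v p ≠ 0}

/-- The basis vector `z_p`. -/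
def zvec (p : P) : QV P := Pi.single p ((1 : ZMod 2), (0 : ZMod 2))

/-- The basis vector `x_p`. -/
def xvec (p : P) : QV P := Pi.single p ((0 : ZMod 2), (1 : ZMod 2))

/-- Restriction (coordinate projection) of a vector to a subset `S ⊆ P`. -/
def restrTo (S : Set P) (v : QV P) : QV P := fun p => if p ∈ S then v p else 0

/-- The coordinate subspace `V^S ⊆ V^P`. -/
def coordSub (S : Set P) : Submodule (ZMod 2) (QV P) where
  carrier := {v | ∀ p ∉ S, v p = 0}
  add_mem' := by intro a b ha hb p hp; simp [Pi.add_apply, ha p hp, hb p hp]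
  zero_mem' := by intro p _; rfl
  smul_mem' := by intro c a ha p hp; simp [Pi.smul_apply, ha p hp]

/-- `L_S := L ∩ V^S`. -/
def LS (L : Submodule (ZMod 2) (QV P)) (S : Set P) : Submodule (ZMod 2) (QV P) :=
  L ⊓ coordSub S

/-- `L` splits as a direct factor on `S`, i.e. `L = L_S × L_{P∖S}`. -/
def SplitsOn (L : Submodule (ZMod 2) (QV P)) (S : Set P) : Prop :=
  ∀ v ∈ L, restrTo S v ∈ L

/-- `L` splits off a zero factor: on some nonempty `S ⊆ P` all vectors of `L` vanish. -/
def HasZeroFactor (L : Submodule (ZMod 2) (QV P)) : Prop :=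
  ∃ S : Set P, S.Nonempty ∧ ∀ v ∈ L, ∀ p ∈ S, v p = 0

/-- The qubit `p` is trivial: `L` splits off a one-dimensional factor on `{p}`. -/
def TrivialQubit (L : Submodule (ZMod 2) (QV P)) (p : P) : Prop :=
  SplitsOn L {p} ∧ ∃ v ∈ L, v ≠ 0 ∧ supp v ⊆ {p}

/-- `L` splits off a trivial factor. -/
def HasTrivialFactor (L : Submodule (ZMod 2) (QV P)) : Prop :=
  ∃ p : P, TrivialQubit L p

/-- `L` splits off a Bell Lagrangian: an indecomposable Lagrangian direct factor on a
two-element set of qubits (all of whose nonzero vectors have full support `{p, q}`). -/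
def HasBellFactor (L : Submodule (ZMod 2) (QV P)) : Prop :=
  ∃ p q : P, p ≠ q ∧ SplitsOn L {p, q} ∧
    ∃ v ∈ L, ∃ w ∈ L, v ≠ w ∧ supp v = {p, q} ∧ supp w = {p, q} ∧ supp (v + w) = {p, q}

/-- The factor `L_S` (for `S` in a partition) is indecomposable. -/
def IndecompWithin (L : Submodule (ZMod 2) (QV P)) (S : Set P) : Prop :=
  ∀ T ⊆ S, SplitsOn L T → T = ∅ ∨ T = S

/-! ### The Hilbert space, Pauli operators and stabilizer codes -/

/-- The state space `ℋ^{⊗P} = (ℂ²)^{⊗P}`, realised concretely as functions on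
computational basis labels. -/
abbrev HP (P : Type) := (P → Fin 2) → ℂ

/-- Operators on `ℋ^{⊗P}` as matrices. -/
abbrev MatP (P : Type) := Matrix (P → Fin 2) (P → Fin 2) ℂ

/-- The tensor (local) operator `⊗_{p} g_p` on `ℋ^{⊗P}`. -/
def locOp (g : P → Matrix (Fin 2) (Fin 2) ℂ) : MatP P :=
  Matrix.of fun u w => ∏ p, g p (u p) (w p)

def sigmaX : Matrix (Fin 2) (Fin 2) ℂ := !![0, 1; 1, 0]
def sigmaY : Matrix (Fin 2) (Fin 2) ℂ := !![0, -Complex.I; Complex.I, 0]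
def sigmaZ : Matrix (Fin 2) (Fin 2) ℂ := !![1, 0; 0, -1]

/-- The one-qubit Pauli operator `Z^a X^b` attached to `(a, b) ∈ V`. -/
def pauliMat (v : V) : Matrix (Fin 2) (Fin 2) ℂ := sigmaZ ^ (v.1 : ZMod 2).val * sigmaX ^ (v.2 : ZMod 2).val

/-- The Pauli (Weyl) operator attached to `v ∈ V^P`. -/
def Wop (v : QV P) : MatP P := locOp fun p => pauliMat (v p)

/-- A group-homomorphic section `σ` over `L` of the projection from the Pauli group
`Ṽ^P` onto `V^P`: each value `σ(v)` is a unitary scalar multiple of the Pauli operator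
`W(v)`, and `σ` is multiplicative on `L`. -/
structure PauliSection (L : Submodule (ZMod 2) (QV P)) where
  toFun : QV P → MatP P
  scalar : ∀ v : QV P, ∃ c : ℂ, toFun v = c • Wop v
  unitary : ∀ v : QV P, toFun v ∈ Matrix.unitaryGroup (P → Fin 2) ℂ
  mul_of_mem : ∀ u ∈ L, ∀ v ∈ L, toFun (u + v) = toFun u * toFun v
  map_zero : toFun 0 = 1

/-- The stabilizer code `C(L, σ)`: the common fixed-point space of the stabilizer
group `σ(L)`. -/
def code (L : Submodule (ZMod 2) (QV P)) (σ : PauliSection L) : Submodule ℂ (HP P) where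
  carrier := {ψ | ∀ v ∈ L, σ.toFun v *ᵥ ψ = ψ}
  add_mem' := by intro a b ha hb v hv; rw [Matrix.mulVec_add, ha v hv, hb v hv]
  zero_mem' := by intro v hv; simp
  smul_mem' := by intro c a ha v hv; rw [Matrix.mulVec_smul, ha v hv]

/-- The standard section: `σ(v) = W(v)` on `L`. -/
def StandardOn (L : Submodule (ZMod 2) (QV P)) (σ : PauliSection L) : Prop :=
  ∀ v ∈ L, σ.toFun v = Wop v

/-! ### `SO(3)`, rotations, and the automorphism group of a code -/

/-- `3×3` real matrices. -/
abbrev Rot : Type := Matrix (Fin 3) (Fin 3) ℝ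

/-- `SO(3)` as a set of `3×3` real matrices. -/
def SO3 : Set Rot := {A | A * Aᵀ = 1 ∧ A.det = 1}

/-- The ordered Pauli basis (x, y, z) of traceless Hermitian `2×2` matrices. -/
def pauliBasis : Fin 3 → Matrix (Fin 2) (Fin 2) ℂ := ![sigmaX, sigmaY, sigmaZ]

/-- The image of a unitary `u ∈ U(2)` in `SO(3)` under the adjoint action on traceless
Hermitian operators (the identification `U(2)/S¹ = SO(3)`):
`u σ_j u† = Σ_i (adjRot u)_{ij} σ_i`. -/
def adjRot (u : Matrix (Fin 2) (Fin 2) ℂ) : Rot :=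
  Matrix.of fun i j =>
    (1 / 2 : ℝ) * ((pauliBasis i * u * pauliBasis j * u.conjTranspose).trace).re

/-- Rotation about the `x`-axis by angle `θ`. -/
def rotX (θ : ℝ) : Rot := !![1, 0, 0; 0, Real.cos θ, -Real.sin θ; 0, Real.sin θ, Real.cos θ]

/-- Rotation about the `y`-axis by angle `θ`. -/
def rotY (θ : ℝ) : Rot := !![Real.cos θ, 0, Real.sin θ; 0, 1, 0; -Real.sin θ, 0, Real.cos θ]

/-- Rotation about the `z`-axis by angle `θ`. -/
def rotZ (θ : ℝ) : Rot := !![Real.cos θ, -Real.sin θ, 0; Real.sin θ, Real.cos θ, 0; 0, 0, 1]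

/-- The circle group `C_x ⊆ SO(3)` of rotations about the `x`-axis. -/
def Cx : Set Rot := Set.range rotX

/-- The circle group `C_y ⊆ SO(3)` of rotations about the `y`-axis. -/
def Cy : Set Rot := Set.range rotY

/-- The circle group `C_z ⊆ SO(3)` of rotations about the `z`-axis. -/
def Cz : Set Rot := Set.range rotZ

/-- The octahedral group: the subgroup of `SO(3)` generated by the rotations by a right
angle about the three coordinate axes. -/
def octahedral : Set Rot :=
  (Submonoid.closure {rotX (π / 2), rotY (π / 2), rotZ (π / 2)} : Submonoid Rot)

/-- The infinite dihedral group `D_x ⊆ SO(3)`. -/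
def Dx : Set Rot := (Submonoid.closure (Cx ∪ {rotZ π}) : Submonoid Rot)

/-- The infinite dihedral group `D_y ⊆ SO(3)`. -/
def Dy : Set Rot := (Submonoid.closure (Cy ∪ {rotZ π}) : Submonoid Rot)

/-- The infinite dihedral group `D_z ⊆ SO(3)`. -/
def Dz : Set Rot := (Submonoid.closure (Cz ∪ {rotX π}) : Submonoid Rot)

/-- The automorphism group `A(L, σ) ⊆ SO(3)^P` of the stabilizer code `C(L, σ)`:
all families of rotations admitting a local unitary lift mapping the code into itself. -/
def autSet (L : Submodule (ZMod 2) (QV P)) (σ : PauliSection L) : Set (P → Rot) :=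
  {g | ∃ u : P → Matrix (Fin 2) (Fin 2) ℂ,
        (∀ p, u p ∈ Matrix.unitaryGroup (Fin 2) ℂ) ∧
        (∀ p, adjRot (u p) = g p) ∧
        ∀ ψ ∈ code L σ, locOp u *ᵥ ψ ∈ code L σ}

/-- The automorphism group `A(L, σ)_p` at the qubit `p`. -/
def autSetAt (L : Submodule (ZMod 2) (QV P)) (σ : PauliSection L) (p : P) : Set Rot :=
  (fun g => g p) '' autSet L σ

/-- The normal subgroup `Z(L, σ)` of automorphisms acting by a scalar on the code. -/
def zSet (L : Submodule (ZMod 2) (QV P)) (σ : PauliSection L) : Set (P → Rot) :=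
  {g | ∃ u : P → Matrix (Fin 2) (Fin 2) ℂ,
        (∀ p, u p ∈ Matrix.unitaryGroup (Fin 2) ℂ) ∧
        (∀ p, adjRot (u p) = g p) ∧
        ∃ c : ℂ, ∀ ψ ∈ code L σ, locOp u *ᵥ ψ = c • ψ}

/-! ### Restriction to subsets of qubits -/

/-- Restriction of a phase-space vector to the qubits of `S`. -/
def resQV (S : Set P) (v : QV P) : QV ↥S := fun s => v s

/-- Restriction as a linear map. -/
def resLin (S : Set P) : QV P →ₗ[ZMod 2] QV ↥S where
  toFun := resQV S
  map_add' := by intros; rfl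
  map_smul' := by intros; rfl

/-- `L_S`, regarded as a subspace of `V^S`. -/
def LSsub (L : Submodule (ZMod 2) (QV P)) (S : Set P) : Submodule (ZMod 2) (QV ↥S) :=
  Submodule.map (resLin S) (LS L S)

/-- The extension `M ⊗ 1` to `ℋ^{⊗P}` of an operator `M` on `ℋ^{⊗S}`. -/
def extendOp (S : Set P) (M : Matrix (↥S → Fin 2) (↥S → Fin 2) ℂ) : MatP P :=
  Matrix.of fun u w =>
    if ∀ p ∉ S, u p = w p then M (fun s => u s) (fun s => w s) else 0

/-- `σ'` is the restriction `σ|_{L_S}` of the section `σ` to `L_S`. -/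
def RestrictedSection (L : Submodule (ZMod 2) (QV P)) (σ : PauliSection L) (S : Set P)
    (σ' : PauliSection (LSsub L S)) : Prop :=
  ∀ v ∈ LS L S, extendOp S (σ'.toFun (resQV S v)) = σ.toFun v

/-! ### Contiguity, protected and gauge qubits, and normal forms -/

/-- Two qubits are contiguous if they are equal or `L` contains a vector supported
exactly on the pair. -/
def Contig (L : Submodule (ZMod 2) (QV P)) (p q : P) : Prop :=
  p = q ∨ ∃ v ∈ L, supp v = ({p, q} : Set P)

/-- The contiguity class of a qubit. -/
def contigClass (L : Submodule (ZMod 2) (QV P)) (p : P) : Set P := {q | Contig L p q}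

/-- The qubit `p` is protected: the projection `L → V^{{p}}` is surjective. -/
def IsProtected (L : Submodule (ZMod 2) (QV P)) (p : P) : Prop :=
  ∀ w : V, ∃ v ∈ L, v p = w

/-- The qubit `p` is of gauge type: the projection `L → V^{{p}}` has a line as image. -/
def IsGauge (L : Submodule (ZMod 2) (QV P)) (p : P) : Prop :=
  ¬ IsProtected L p ∧ ∃ v ∈ L, v p ≠ 0

/-- The subspace `⟨z_a + z_b : a ≠ b ∈ S⟩`. -/
def zspan (S : Set P) : Submodule (ZMod 2) (QV P) :=
  Submodule.span (ZMod 2) {w | ∃ a ∈ S, ∃ b ∈ S, a ≠ b ∧ w = zvec a + zvec b}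

/-- The vector `Σ_{s ∈ S} x_s`. -/
def xsumOn (S : Set P) : QV P := S.indicator fun _ => ((0 : ZMod 2), (1 : ZMod 2))

/-- Normal form of `L` (conclusion of the normalisation lemma): every contiguity class `S`
carries either `⟨z_a + z_b⟩` or `⟨z_a + z_b⟩ + ⟨Σ_{s∈S} x_s⟩`. -/
def NormalForm (L : Submodule (ZMod 2) (QV P)) : Prop :=
  ∀ p : P,
    LS L (contigClass L p) = zspan (contigClass L p) ∨
    LS L (contigClass L p) =
      zspan (contigClass L p) ⊔ Submodule.span (ZMod 2) {xsumOn (contigClass L p)}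

/-- The pair `(L, σ)` is normalised. -/
def Normalised (L : Submodule (ZMod 2) (QV P)) (σ : PauliSection L) : Prop :=
  NormalForm L ∧
  (∀ p : P, IsGauge L p → contigClass L p = {p} → ∀ v ∈ L, (v p).2 = 0) ∧
  (∀ p : P, IsProtected L p → contigClass L p = {p} →
    connectedComponentIn (autSetAt L σ p) 1 ⊆ Cz) ∧
  (∀ p : P, IsProtected L p → contigClass L p ≠ {p} →
    LS L (contigClass L p) = zspan (contigClass L p) →
    ∃ v ∈ L, ∀ s ∈ contigClass L p, v s = ((0 : ZMod 2), (1 : ZMod 2))) ∧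
  (∀ p q : P, p ≠ q → Contig L p q →
    σ.toFun (zvec p + zvec q) = Wop (zvec p + zvec q))

/-- A local symplectic family of automorphisms of `V`. -/
def IsLocalSymp (f : P → (V ≃ₗ[ZMod 2] V)) : Prop :=
  ∀ (p : P) (u v : V), omegaV (f p u) (f p v) = omegaV u v

/-- The image of `L` under a local (symplectic) transformation. -/
def mapL (L : Submodule (ZMod 2) (QV P)) (f : P → (V ≃ₗ[ZMod 2] V)) :
    Submodule (ZMod 2) (QV P) :=
  Submodule.map (LinearEquiv.piCongrRight f : QV P ≃ₗ[ZMod 2] QV P).toLinearMap L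

/-! ### Abstract group structures carried by subsets of a monoid -/

/-- The set `s` carries the structure of a solvable group. -/
structure SolvableGroupStructure (M : Type) [Monoid M] (s : Set M) where
  G : Type
  [grp : Group G]
  solv : IsSolvable G
  f : G → M
  inj : Function.Injective f
  map_mul : ∀ a b : G, f (a * b) = f a * f b
  range_eq : Set.range f = s

/-- The quotient of the group (carried by) `A` by the normal subgroup (carried by) `Z`
is a compact solvable topological (Lie) group. -/
structure CompactSolvableQuotientStructure (M : Type) [Monoid M] [TopologicalSpace M]
    (A Z : Set M) where
  G : Type
  [grp : Group G]
  [top : TopologicalSpace G]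
  [tgrp : IsTopologicalGroup G]
  cpt : CompactSpace G
  solv : IsSolvable G
  φ : M → G
  cont : ContinuousOn φ A
  map_mul' : ∀ a ∈ A, ∀ b ∈ A, φ (a * b) = φ a * φ b
  surj : ∀ y : G, ∃ a ∈ A, φ a = y
  ker : ∀ a ∈ A, (φ a = 1 ↔ a ∈ Z)

/-! ### Logical qubits and transversally realisable gates -/

/-- The standard hermitian inner product on a finite-dimensional function space. -/
def innerF {ι : Type} [Fintype ι] (ψ φ : ι → ℂ) : ℂ := ∑ i, (starRingEnd ℂ) (ψ i) * φ i

/-- `e` is a unitary identification of the code space with a space of logical qubits. -/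
def IsUnitaryEquiv (L : Submodule (ZMod 2) (QV P)) (σ : PauliSection L) {d : ℕ}
    (e : ↥(code L σ) ≃ₗ[ℂ] HP (Fin d)) : Prop :=
  ∀ ψ φ : ↥(code L σ),
    innerF (e ψ) (e φ) = innerF (ψ : HP P) (φ : HP P)

/-- The operator acting as `w` on the logical qubit `k` and trivially elsewhere. -/
def oneQubitOp (d : ℕ) (k : Fin d) (w : Matrix (Fin 2) (Fin 2) ℂ) : MatP (Fin d) :=
  locOp fun j => if j = k then w else 1

/-- The set of rotations in `SO(3)` induced, via the identification `e`, on a fixed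
logical qubit `k` by (exactly realised) transversal gates, i.e. by elements of `A(L, σ)`. -/
def logicalSet (L : Submodule (ZMod 2) (QV P)) (σ : PauliSection L) {d : ℕ}
    (e : ↥(code L σ) ≃ₗ[ℂ] HP (Fin d)) (k : Fin d) : Set Rot :=
  {A | ∃ w ∈ Matrix.unitaryGroup (Fin 2) ℂ, adjRot w = A ∧
        ∃ u : P → Matrix (Fin 2) (Fin 2) ℂ,
          (∀ p, u p ∈ Matrix.unitaryGroup (Fin 2) ℂ) ∧
          ∀ φ : HP (Fin d),
            locOp u *ᵥ ((e.symm φ : HP P)) = ((e.symm (oneQubitOp d k w *ᵥ φ) : HP P))}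

/-! ### Reed–Muller codes -/

/-- The qubit set `P = 𝔽₂^m ∖ {0}`. -/
abbrev RMQubits (m : ℕ) := {s : Fin m → ZMod 2 // s ≠ 0}

/-- Polynomial functions on `𝔽₂^m` of degree at most `r` with zero constant term. -/
def RMspan (r m : ℕ) : Submodule (ZMod 2) ((Fin m → ZMod 2) → ZMod 2) :=
  Submodule.span (ZMod 2)
    {f | ∃ I : Finset (Fin m), I.Nonempty ∧ I.card ≤ r ∧ f = fun s => ∏ i ∈ I, s i}

/-- The shortened Reed–Muller code `R_*(r, m) ⊆ 𝔽₂^P`. -/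
def RMstar (r m : ℕ) : Submodule (ZMod 2) (RMQubits m → ZMod 2) :=
  Submodule.map (LinearMap.funLeft (ZMod 2) (ZMod 2) Subtype.val) (RMspan r m)

/-- The `z`-part of a phase-space vector. -/
def zPart {P : Type} : QV P →ₗ[ZMod 2] (P → ZMod 2) where
  toFun v := fun p => (v p).1
  map_add' := by intros; rfl
  map_smul' := by intros; rfl

/-- The `x`-part of a phase-space vector. -/
def xPart {P : Type} : QV P →ₗ[ZMod 2] (P → ZMod 2) where
  toFun v := fun p => (v p).2
  map_add' := by intros; rfl
  map_smul' := by intros; rfl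

/-- The Calderbank–Shor–Steane isotropic subspace built from the shortened Reed–Muller
codes `R_*(m−2, m)` (in the `z`-coordinates) and `R_*(1, m)` (in the `x`-coordinates). -/
def cssL (m : ℕ) : Submodule (ZMod 2) (QV (RMQubits m)) :=
  Submodule.comap zPart (RMstar (m - 2) m) ⊓ Submodule.comap xPart (RMstar 1 m)

/-- The stabilizer state `|0⟩_S ⊗ |0⟩_T + |0⟩_S ⊗ |1⟩_T + |1⟩_S ⊗ |0⟩_T − |1⟩_S ⊗ |1⟩_T`
(with `T = Sᶜ`), written in the computational basis. -/
def bellLike (S : Set P) (p q : P) : HP P := fun u =>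
  if (∀ a ∈ S, u a = u p) ∧ (∀ a ∈ Sᶜ, u a = u q) then
    ((-1 : ℂ)) ^ ((u p : Fin 2).val * (u q : Fin 2).val) else 0


/-! ### Local operators -/

theorem locOp_mul (f g : P → Matrix (Fin 2) (Fin 2) ℂ) :
    locOp f * locOp g = locOp (fun p => f p * g p) := by
  ext u w
  simp only [locOp, Matrix.mul_apply, Matrix.of_apply, ← Finset.prod_mul_distrib]
  rw [Finset.prod_univ_sum, Fintype.piFinset_univ]

omit [DecidableEq P] in
theorem locOp_one : locOp (fun _ : P => (1 : Matrix (Fin 2) (Fin 2) ℂ)) = 1 := by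
  ext u w
  simp only [locOp, Matrix.of_apply, Matrix.one_apply]
  rw [Fintype.prod_ite_zero]
  simp [funext_iff]

omit [DecidableEq P] in
theorem locOp_smul (c : P → ℂ) (f : P → Matrix (Fin 2) (Fin 2) ℂ) :
    locOp (fun p => c p • f p) = (∏ p, c p) • locOp f := by
  ext u w
  simp [locOp, Finset.prod_mul_distrib]

theorem trace_locOp (f : P → Matrix (Fin 2) (Fin 2) ℂ) :
    (locOp f).trace = ∏ p, (f p).trace := by
  simp only [locOp, Matrix.trace, Matrix.diag, Matrix.of_apply]
  rw [Finset.prod_univ_sum, Fintype.piFinset_univ]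

/-- The operator acting as `A` on the qubit `p` and trivially elsewhere. -/
def siteOp (p : P) (A : Matrix (Fin 2) (Fin 2) ℂ) : MatP P :=
  locOp (Function.update (fun _ => 1) p A)

theorem siteOp_apply (p : P) (A : Matrix (Fin 2) (Fin 2) ℂ) (u w : P → Fin 2) :
    siteOp p A u w =
      A (u p) (w p) * ∏ r ∈ Finset.univ.erase p, (1 : Matrix (Fin 2) (Fin 2) ℂ) (u r) (w r) := by
  simp only [siteOp, locOp, Matrix.of_apply]
  rw [← Finset.mul_prod_erase _ _ (Finset.mem_univ p), Function.update_self]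
  congr 1
  refine Finset.prod_congr rfl fun r hr => ?_
  rw [Function.update_of_ne (Finset.ne_of_mem_erase hr)]

theorem siteOp_add (p : P) (A B : Matrix (Fin 2) (Fin 2) ℂ) :
    siteOp p (A + B) = siteOp p A + siteOp p B := by
  ext u w
  simp only [Matrix.add_apply, siteOp_apply, add_mul]

theorem siteOp_smul (p : P) (c : ℂ) (A : Matrix (Fin 2) (Fin 2) ℂ) :
    siteOp p (c • A) = c • siteOp p A := by
  ext u w
  simp only [Matrix.smul_apply, siteOp_apply, smul_eq_mul, mul_assoc]

theorem siteOp_one (p : P) : siteOp p (1 : Matrix (Fin 2) (Fin 2) ℂ) = 1 := by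
  rw [siteOp, show Function.update (fun _ : P => (1 : Matrix (Fin 2) (Fin 2) ℂ)) p 1 = fun _ => 1
    from Function.update_eq_self p _, locOp_one]

theorem siteOp_mul (p : P) (A B : Matrix (Fin 2) (Fin 2) ℂ) :
    siteOp p (A * B) = siteOp p A * siteOp p B := by
  rw [siteOp, siteOp, siteOp, locOp_mul]
  congr 1
  funext r
  by_cases h : r = p
  · subst h; simp
  · simp [h]

/-! ### Hermitian Pauli operators -/

theorem V_cases (w : V) : w = 0 ∨ w = (0, 1) ∨ w = (1, 0) ∨ w = (1, 1) := by
  revert w; decide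

/-- The Hermitian one-qubit Pauli operator attached to `w ∈ V`. -/
def hPauli (w : V) : Matrix (Fin 2) (Fin 2) ℂ :=
  (if w = (1, 1) then Complex.I else 1) • pauliMat w

theorem hPauli_zero : hPauli 0 = 1 := by
  simp [hPauli, pauliMat, Prod.ext_iff]

theorem hPauli_x : hPauli (0, 1) = sigmaX := by
  simp [hPauli, pauliMat, ZMod.val_one]

theorem hPauli_z : hPauli (1, 0) = sigmaZ := by
  simp [hPauli, pauliMat, ZMod.val_one]

theorem hPauli_y : hPauli (1, 1) = !![0, Complex.I; -Complex.I, 0] := by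
  simp [hPauli, pauliMat, ZMod.val_one, sigmaX, sigmaZ]

theorem hPauli_mul_self (w : V) : hPauli w * hPauli w = 1 := by
  rcases V_cases w with rfl | rfl | rfl | rfl
  · simp [hPauli_zero]
  · simp [hPauli_x, sigmaX, Matrix.one_fin_two]
  · simp [hPauli_z, sigmaZ, Matrix.one_fin_two]
  · simp [hPauli_y, Matrix.one_fin_two]

theorem conjTranspose_hPauli (w : V) : (hPauli w)ᴴ = hPauli w := by
  rcases V_cases w with rfl | rfl | rfl | rfl
  · simp [hPauli_zero]
  · ext i j; fin_cases i <;> fin_cases j <;> simp [hPauli_x, sigmaX]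
  · ext i j; fin_cases i <;> fin_cases j <;> simp [hPauli_z, sigmaZ]
  · ext i j; fin_cases i <;> fin_cases j <;> simp [hPauli_y]

theorem hPauli_mem_unitary (w : V) : hPauli w ∈ Matrix.unitaryGroup (Fin 2) ℂ := by
  rw [Matrix.mem_unitaryGroup_iff, Matrix.star_eq_conjTranspose, conjTranspose_hPauli,
    hPauli_mul_self]

/-- Products of Hermitian Pauli operators: the phase is `1` if the factors coincide or one of
them is the identity, and it is imaginary if they are distinct and not the identity. -/
theorem hPauli_mul (a w : V) : ∃ κ : ℂ, ‖κ‖ = 1 ∧ hPauli a * hPauli w = κ • hPauli (a + w) ∧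
    (a = 0 ∨ a = w → κ = 1) ∧ (a ≠ 0 → w ≠ 0 → a ≠ w → κ.re = 0) := by
  have e1 : ((0, 1) : V) + (1, 0) = (1, 1) := by decide
  have e2 : ((0, 1) : V) + (1, 1) = (1, 0) := by decide
  have e3 : ((1, 0) : V) + (0, 1) = (1, 1) := by decide
  have e4 : ((1, 0) : V) + (1, 1) = (0, 1) := by decide
  have e5 : ((1, 1) : V) + (0, 1) = (1, 0) := by decide
  have e6 : ((1, 1) : V) + (1, 0) = (0, 1) := by decide
  by_cases h0 : a = 0
  · exact ⟨1, by simp, by simp [h0, hPauli_zero], by simp, by simp [h0]⟩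
  by_cases h1 : a = w
  · subst h1
    refine ⟨1, by simp, ?_, by simp, by simp⟩
    rw [hPauli_mul_self, show a + a = 0 from ?_, hPauli_zero, one_smul]
    revert a; decide
  by_cases h2 : w = 0
  · exact ⟨1, by simp, by simp [h2, hPauli_zero], by simp, by simp [h2]⟩
  suffices ∃ κ : ℂ, ‖κ‖ = 1 ∧ hPauli a * hPauli w = κ • hPauli (a + w) ∧ κ.re = 0 by
    obtain ⟨κ, k1, k2, k3⟩ := this
    exact ⟨κ, k1, k2, fun h => absurd h (by tauto), fun _ _ _ => k3⟩
  rcases V_cases a with rfl | rfl | rfl | rfl <;> rcases V_cases w with rfl | rfl | rfl | rfl <;>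
    first
    | exact absurd rfl h0
    | exact absurd rfl h1
    | exact absurd rfl h2
    | skip
  · exact ⟨Complex.I, by simp, by simp [e1, hPauli_x, hPauli_z, hPauli_y, sigmaX, sigmaZ], by simp⟩
  · exact ⟨-Complex.I, by simp, by simp [e2, hPauli_x, hPauli_z, hPauli_y, sigmaX, sigmaZ], by simp⟩
  · exact ⟨-Complex.I, by simp, by simp [e3, hPauli_x, hPauli_z, hPauli_y, sigmaX, sigmaZ], by simp⟩
  · exact ⟨Complex.I, by simp, by simp [e4, hPauli_x, hPauli_z, hPauli_y, sigmaX, sigmaZ], by simp⟩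
  · exact ⟨Complex.I, by simp, by simp [e5, hPauli_x, hPauli_z, hPauli_y, sigmaX, sigmaZ], by simp⟩
  · exact ⟨-Complex.I, by simp, by simp [e6, hPauli_x, hPauli_z, hPauli_y, sigmaX, sigmaZ], by simp⟩

theorem hPauli_anticomm {a w : V} (ha : a ≠ 0) (hw : w ≠ 0) (h : a ≠ w) :
    hPauli a * hPauli w = -(hPauli w * hPauli a) := by
  rcases V_cases a with rfl | rfl | rfl | rfl <;> rcases V_cases w with rfl | rfl | rfl | rfl <;>
    first
    | exact absurd rfl ha
    | exact absurd rfl hw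
    | exact absurd rfl h
    | simp [hPauli_x, hPauli_z, hPauli_y, sigmaX, sigmaZ]

/-- The Hermitian Pauli operator attached to `v ∈ V^P`. -/
def hOp (v : QV P) : MatP P := locOp fun p => hPauli (v p)

theorem hOp_mul_self (v : QV P) : hOp v * hOp v = 1 := by
  rw [hOp, locOp_mul, ← locOp_one]
  simp only [hPauli_mul_self]

theorem hOp_single (p : P) (w : V) : hOp (Pi.single p w) = siteOp p (hPauli w) := by
  rw [hOp, siteOp]
  congr 1
  funext r
  by_cases h : r = p
  · subst h; simp
  · simp [h, hPauli_zero]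

theorem hOp_single_add_single {p q : P} (hpq : p ≠ q) (w w' : V) :
    hOp (Pi.single p w + Pi.single q w') = siteOp p (hPauli w) * siteOp q (hPauli w') := by
  rw [hOp, siteOp, siteOp, locOp_mul]
  congr 1
  funext r
  by_cases h : r = p
  · subst h; simp [hpq]
  · by_cases h' : r = q
    · subst h'; simp [h]
    · simp [h, h', hPauli_zero]

/-- The values of a Pauli section on `L` are Hermitian Pauli operators up to a sign. -/
theorem PauliSection.exists_sign {L : Submodule (ZMod 2) (QV P)} (σ : PauliSection L)
    {l : QV P} (hl : l ∈ L) : ∃ d : ℝ, d * d = 1 ∧ σ.toFun l = (d : ℂ) • hOp l := by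
  obtain ⟨c, hc⟩ := σ.scalar l
  have hW : hOp l = (∏ p, if l p = (1, 1) then Complex.I else 1) • Wop l := by
    rw [hOp, Wop, ← locOp_smul]; rfl
  have hne : (∏ p, if l p = (1, 1) then Complex.I else 1) ≠ 0 := by
    refine Finset.prod_ne_zero_iff.2 fun p _ => ?_
    split_ifs <;> simp
  set k := ∏ p, if l p = (1, 1) then Complex.I else 1
  have h1 : σ.toFun l = (c * k⁻¹) • hOp l := by
    rw [hc, hW, smul_smul, mul_assoc, inv_mul_cancel₀ hne, mul_one]
  have h2 : (c * k⁻¹) * (c * k⁻¹) = 1 := by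
    have h := σ.mul_of_mem l hl l hl
    have hll : l + l = 0 := by
      funext p
      have : ∀ v : V, v + v = 0 := by decide
      exact this (l p)
    rw [hll, σ.map_zero, h1, smul_mul_smul_comm, hOp_mul_self] at h
    have := congrFun (congrFun h (fun _ => 0)) (fun _ => 0)
    simpa using this.symm
  rcases mul_self_eq_one_iff.1 h2 with h | h
  · exact ⟨1, by norm_num, by rw [h1, h]; simp⟩
  · exact ⟨-1, by norm_num, by rw [h1, h]; simp⟩

/-! ### The rotation attached to a unitary operator -/

theorem traceless_eq_sum_pauli {M : Matrix (Fin 2) (Fin 2) ℂ} (hM : M.trace = 0) :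
    M = ∑ k, ((1 / 2 : ℂ) * (pauliBasis k * M).trace) • pauliBasis k := by
  rw [Matrix.trace_fin_two] at hM
  have h11 : M 1 1 = -M 0 0 := by linear_combination hM
  ext i j
  fin_cases i <;> fin_cases j <;>
    simp [Fin.sum_univ_three, pauliBasis, sigmaX, sigmaY, sigmaZ, Matrix.trace_fin_two,
      Matrix.mul_apply, h11] <;> ring_nf <;> simp <;> ring

theorem conjTranspose_pauliBasis (k : Fin 3) : (pauliBasis k)ᴴ = pauliBasis k := by
  ext i j
  fin_cases k <;> fin_cases i <;> fin_cases j <;> simp [pauliBasis, sigmaX, sigmaY, sigmaZ]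

theorem trace_pauliBasis (k : Fin 3) : (pauliBasis k).trace = 0 := by
  fin_cases k <;> simp [pauliBasis, sigmaX, sigmaY, sigmaZ, Matrix.trace_fin_two]

theorem adjRot_apply_complex (u : Matrix (Fin 2) (Fin 2) ℂ) (i j : Fin 3) :
    ((adjRot u i j : ℝ) : ℂ) = (1 / 2 : ℂ) * (pauliBasis i * u * pauliBasis j * uᴴ).trace := by
  have him : (pauliBasis i * u * pauliBasis j * uᴴ).trace.im = 0 := by
    rw [← Complex.conj_eq_iff_im, ← Complex.star_def, ← Matrix.trace_conjTranspose]
    simp only [Matrix.conjTranspose_mul, Matrix.conjTranspose_conjTranspose,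
      conjTranspose_pauliBasis]
    rw [Matrix.trace_mul_comm (pauliBasis i * u * pauliBasis j)]
    rw [← Matrix.mul_assoc, ← Matrix.mul_assoc, Matrix.trace_mul_comm _ (pauliBasis i),
      Matrix.trace_mul_comm uᴴ]
    simp only [Matrix.mul_assoc]
  rw [adjRot, Matrix.of_apply]
  apply Complex.ext <;> simp [him]

theorem adjRot_mul {u v : Matrix (Fin 2) (Fin 2) ℂ} (hv : v ∈ Matrix.unitaryGroup (Fin 2) ℂ) :
    adjRot (u * v) = adjRot u * adjRot v := by
  ext i j
  have hM : (v * pauliBasis j * vᴴ).trace = 0 := by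
    rw [Matrix.mul_assoc, Matrix.trace_mul_comm, Matrix.mul_assoc, ← Matrix.star_eq_conjTranspose,
      Matrix.mem_unitaryGroup_iff'.1 hv, Matrix.mul_one, trace_pauliBasis]
  apply Complex.ofReal_injective
  rw [adjRot_apply_complex, Matrix.mul_apply, Complex.ofReal_sum]
  simp only [Complex.ofReal_mul, adjRot_apply_complex, Matrix.conjTranspose_mul]
  rw [show pauliBasis i * (u * v) * pauliBasis j * (vᴴ * uᴴ) =
    pauliBasis i * u * (v * pauliBasis j * vᴴ) * uᴴ by simp only [Matrix.mul_assoc]]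
  conv_lhs => rw [traceless_eq_sum_pauli hM]
  simp only [Matrix.sum_mul, Matrix.trace_sum, Finset.mul_sum, Matrix.mul_smul,
    Matrix.smul_mul, Matrix.trace_smul, smul_eq_mul]
  refine Finset.sum_congr rfl fun k _ => ?_
  simp only [Matrix.mul_assoc]
  ring

/-! ### Groups of local unitary operators -/

/-- The group of families of one-qubit unitary operators. -/
abbrev LocU (P : Type) := P → Matrix.unitaryGroup (Fin 2) ℂ

/-- The representation of the group of local unitaries on the state space. -/
def locURep : LocU P →* MatP P where
  toFun g := locOp fun p => (g p : Matrix (Fin 2) (Fin 2) ℂ)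
  map_one' := locOp_one
  map_mul' _ _ := (locOp_mul _ _).symm

theorem locURep_apply (g : LocU P) :
    locURep g = locOp fun p => (g p : Matrix (Fin 2) (Fin 2) ℂ) := rfl

theorem locURep_mulSingle (p : P) (x : Matrix.unitaryGroup (Fin 2) ℂ) :
    locURep (Pi.mulSingle p x) = siteOp p (x : Matrix (Fin 2) (Fin 2) ℂ) := by
  rw [locURep_apply, siteOp]
  congr 1
  funext r
  by_cases h : r = p
  · subst h; simp
  · simp [h]

theorem locURep_inv_mulVec (g : LocU P) (ψ : HP P) : locURep g⁻¹ *ᵥ (locURep g *ᵥ ψ) = ψ := by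
  rw [Matrix.mulVec_mulVec, ← map_mul, inv_mul_cancel, map_one, Matrix.one_mulVec]

/-- The group of local unitaries mapping the code into itself. -/
def autGroup (L : Submodule (ZMod 2) (QV P)) (σ : PauliSection L) : Subgroup (LocU P) where
  carrier := {g | ∀ ψ ∈ code L σ, locURep g *ᵥ ψ ∈ code L σ}
  one_mem' := by intro ψ hψ; simpa using hψ
  mul_mem' := by
    intro g h hg hh ψ hψ
    rw [map_mul, ← Matrix.mulVec_mulVec]
    exact hg _ (hh _ hψ)
  inv_mem' := by
    intro g hg ψ hψ
    let T : code L σ →ₗ[ℂ] code L σ := (Matrix.toLin' (locURep g)).restrict hg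
    have hT : Function.Injective T := by
      intro a b hab
      have h : locURep g *ᵥ (a : HP P) = locURep g *ᵥ (b : HP P) := congrArg Subtype.val hab
      apply Subtype.ext
      rw [← locURep_inv_mulVec g a, h, locURep_inv_mulVec]
    obtain ⟨a, ha⟩ := LinearMap.injective_iff_surjective.1 hT ⟨ψ, hψ⟩
    have h : locURep g *ᵥ (a : HP P) = ψ := congrArg Subtype.val ha
    rw [← h, locURep_inv_mulVec]
    exact a.2

/-- The group of local unitaries acting by a scalar on the code. -/
def scalarGroup (L : Submodule (ZMod 2) (QV P)) (σ : PauliSection L) : Subgroup (LocU P) where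
  carrier := {g | ∃ c : ℂ, ∀ ψ ∈ code L σ, locURep g *ᵥ ψ = c • ψ}
  one_mem' := ⟨1, by intro ψ _; simp⟩
  mul_mem' := by
    rintro g h ⟨c, hc⟩ ⟨d, hd⟩
    refine ⟨d * c, fun ψ hψ => ?_⟩
    rw [map_mul, ← Matrix.mulVec_mulVec, hd ψ hψ, Matrix.mulVec_smul, hc ψ hψ, smul_smul]
  inv_mem' := by
    rintro g ⟨c, hc⟩
    refine ⟨c⁻¹, fun ψ hψ => ?_⟩
    have h := locURep_inv_mulVec g ψ
    rw [hc ψ hψ, Matrix.mulVec_smul] at h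
    by_cases h0 : c = 0
    · rw [h0, zero_smul] at h
      simp [← h]
    · conv_rhs => rw [← h, smul_smul, inv_mul_cancel₀ h0, one_smul]

theorem scalarGroup_le_autGroup (L : Submodule (ZMod 2) (QV P)) (σ : PauliSection L) :
    scalarGroup L σ ≤ autGroup L σ := by
  rintro g ⟨c, hc⟩ ψ hψ
  rw [hc ψ hψ]
  exact (code L σ).smul_mem c hψ

theorem continuous_locURep : Continuous (locURep : LocU P → MatP P) := by
  refine continuous_pi fun u => continuous_pi fun w => ?_
  simp only [locURep_apply, locOp, Matrix.of_apply]
  refine continuous_finsetProd _ fun p _ => ?_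
  have h : Continuous fun g : LocU P => (g p : Matrix (Fin 2) (Fin 2) ℂ) :=
    continuous_subtype_val.comp (continuous_apply p)
  exact h.matrix_elem _ _

theorem continuous_locURep_mulVec (ψ : HP P) : Continuous fun g : LocU P => locURep g *ᵥ ψ :=
  continuous_locURep.matrix_mulVec continuous_const

theorem isClosed_autGroup (L : Submodule (ZMod 2) (QV P)) (σ : PauliSection L) :
    IsClosed (autGroup L σ : Set (LocU P)) := by
  have h : (autGroup L σ : Set (LocU P)) =
      ⋂ ψ ∈ code L σ, ⋂ v ∈ L, {g | σ.toFun v *ᵥ (locURep g *ᵥ ψ) = locURep g *ᵥ ψ} := by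
    ext g
    simp only [Set.mem_iInter, Set.mem_ofPred_eq]
    rfl
  rw [h]
  refine isClosed_biInter fun ψ _ => isClosed_biInter fun v _ => isClosed_eq ?_ ?_
  · exact continuous_const.matrix_mulVec (continuous_locURep_mulVec ψ)
  · exact continuous_locURep_mulVec ψ

theorem isClosed_scalarGroup (L : Submodule (ZMod 2) (QV P)) (σ : PauliSection L) :
    IsClosed (scalarGroup L σ : Set (LocU P)) := by
  by_cases hbot : ∀ ψ ∈ code L σ, ψ = 0
  · have h : (scalarGroup L σ : Set (LocU P)) = Set.univ := by
      refine Set.eq_univ_of_forall fun g => ⟨0, fun ψ hψ => ?_⟩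
      simp [hbot ψ hψ]
    rw [h]
    exact isClosed_univ
  · push Not at hbot
    obtain ⟨φ, hφ, hφ0⟩ := hbot
    obtain ⟨i, hi⟩ := Function.ne_iff.1 hφ0
    have h : (scalarGroup L σ : Set (LocU P)) =
        ⋂ ψ ∈ code L σ, {g | locURep g *ᵥ ψ = ((locURep g *ᵥ φ) i / φ i) • ψ} := by
      ext g
      simp only [Set.mem_iInter, Set.mem_ofPred_eq]
      constructor
      · rintro ⟨c, hc⟩ ψ hψ
        rw [hc ψ hψ, hc φ hφ, Pi.smul_apply, smul_eq_mul, mul_div_cancel_right₀ _ hi]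
      · exact fun h => ⟨_, h⟩
    rw [h]
    refine isClosed_biInter fun ψ _ => isClosed_eq (continuous_locURep_mulVec ψ) ?_
    have h1 : Continuous fun g : LocU P => (locURep g *ᵥ φ) i :=
      (continuous_apply i).comp (continuous_locURep_mulVec φ)
    exact (h1.div_const _).smul continuous_const

theorem compactSpace_unitaryGroup (n : Type) [Fintype n] [DecidableEq n] :
    CompactSpace (Matrix.unitaryGroup n ℂ) := by
  have hK : IsCompact (Set.pi Set.univ fun _ : n => Set.pi Set.univ fun _ : n =>
      Metric.closedBall (0 : ℂ) 1) :=
    isCompact_univ_pi fun _ => isCompact_univ_pi fun _ => isCompact_closedBall 0 1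
  refine isCompact_iff_compactSpace.1 (hK.of_isClosed_subset
    (isClosed_unitary (R := Matrix n n ℂ)) fun u hu i _ j _ => ?_)
  rw [mem_closedBall_zero_iff]
  exact entry_norm_bound_of_unitary hu i j

theorem norm_half_trace_le_one {u : Matrix (Fin 2) (Fin 2) ℂ}
    (hu : u ∈ Matrix.unitaryGroup (Fin 2) ℂ) : ‖u.trace / 2‖ ≤ 1 := by
  rw [Matrix.trace_fin_two, norm_div, Complex.norm_ofNat, div_le_one (by norm_num)]
  calc ‖u 0 0 + u 1 1‖ ≤ ‖u 0 0‖ + ‖u 1 1‖ := norm_add_le _ _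
    _ ≤ 2 := by linarith [entry_norm_bound_of_unitary hu 0 0, entry_norm_bound_of_unitary hu 1 1]

/-! ### Pauli coefficients and one-parameter groups of rotations -/

/-- The coefficient of the Hermitian Pauli operator of `w` in a one-qubit operator. -/
def pauliCoeff (w : V) (u : Matrix (Fin 2) (Fin 2) ℂ) : ℂ := (hPauli w * u).trace / 2

theorem norm_pauliCoeff_le_one (w : V) {u : Matrix (Fin 2) (Fin 2) ℂ}
    (hu : u ∈ Matrix.unitaryGroup (Fin 2) ℂ) : ‖pauliCoeff w u‖ ≤ 1 :=
  norm_half_trace_le_one (mul_mem (hPauli_mem_unitary w) hu)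

theorem pauliCoeff_zero (u : Matrix (Fin 2) (Fin 2) ℂ) : pauliCoeff 0 u = u.trace / 2 := by
  rw [pauliCoeff, hPauli_zero, one_mul]

theorem expPauli_mem (w : V) (θ : ℝ) :
    (Real.cos θ : ℂ) • (1 : Matrix (Fin 2) (Fin 2) ℂ) + (Complex.I * Real.sin θ) • hPauli w ∈
      Matrix.unitaryGroup (Fin 2) ℂ := by
  have h : (Real.cos θ : ℂ) * Real.cos θ + Real.sin θ * Real.sin θ = 1 := by
    exact_mod_cast (by nlinarith [Real.sin_sq_add_cos_sq θ] :
      Real.cos θ * Real.cos θ + Real.sin θ * Real.sin θ = 1)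
  rw [Matrix.mem_unitaryGroup_iff, Matrix.star_eq_conjTranspose, Matrix.conjTranspose_add,
    Matrix.conjTranspose_smul, Matrix.conjTranspose_smul, Matrix.conjTranspose_one,
    conjTranspose_hPauli]
  simp only [add_mul, mul_add, smul_mul_smul_comm, hPauli_mul_self, one_mul, mul_one, star_mul',
    Complex.star_def, Complex.conj_ofReal, Complex.conj_I]
  generalize Real.cos θ = c at h ⊢
  generalize Real.sin θ = s at h ⊢
  match_scalars
  · linear_combination h - (s * s : ℂ) * Complex.I_mul_I
  · ring

/-- The one-qubit unitary operator `exp (i θ H)` with `H` the Hermitian Pauli operator of `w`. -/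
def expPauli (w : V) (θ : ℝ) : Matrix.unitaryGroup (Fin 2) ℂ :=
  ⟨(Real.cos θ : ℂ) • (1 : Matrix (Fin 2) (Fin 2) ℂ) + (Complex.I * Real.sin θ) • hPauli w,
    expPauli_mem w θ⟩

theorem siteOp_expPauli (p : P) (w : V) (θ : ℝ) :
    siteOp p (expPauli w θ : Matrix (Fin 2) (Fin 2) ℂ) =
      (Real.cos θ : ℂ) • 1 + (Complex.I * Real.sin θ) • siteOp p (hPauli w) := by
  rw [expPauli, siteOp_add, siteOp_smul, siteOp_smul, siteOp_one]

theorem half_trace_mul_expPauli (u : Matrix (Fin 2) (Fin 2) ℂ) (w : V) (θ : ℝ) :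
    ((u * (expPauli w θ : Matrix (Fin 2) (Fin 2) ℂ)).trace / 2).re =
      Real.cos θ * (u.trace / 2).re - Real.sin θ * (pauliCoeff w u).im := by
  have h : (u * (expPauli w θ : Matrix (Fin 2) (Fin 2) ℂ)).trace / 2 =
      Real.cos θ * (u.trace / 2) + Complex.I * (Real.sin θ * pauliCoeff w u) := by
    rw [pauliCoeff, Matrix.trace_mul_comm (hPauli w)]
    simp only [expPauli, Matrix.mul_add, Matrix.mul_smul, Matrix.mul_one, Matrix.trace_add,
      Matrix.trace_smul, smul_eq_mul]
    ring
  rw [h, Complex.add_re, Complex.re_ofReal_mul, Complex.I_mul_re, Complex.im_ofReal_mul]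
  ring

theorem eq_zero_of_cos_sin_le {A B : ℝ} (h : ∀ θ, A * Real.cos θ - B * Real.sin θ ≤ A) :
    B = 0 := by
  have hmax : IsLocalMax (fun θ => A * Real.cos θ - B * Real.sin θ) 0 :=
    Filter.Eventually.of_forall fun θ => by simpa using h θ
  have hd : HasDerivAt (fun θ => A * Real.cos θ - B * Real.sin θ)
      (A * -Real.sin 0 - B * Real.cos 0) 0 :=
    ((Real.hasDerivAt_cos 0).const_mul A).sub ((Real.hasDerivAt_sin 0).const_mul B)
  simpa using hmax.hasDerivAt_eq_zero hd

theorem expPauli_mem_scalarGroup {L : Submodule (ZMod 2) (QV P)} (σ : PauliSection L) {p : P}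
    {w : V} (hl : Pi.single p w ∈ L) (θ : ℝ) :
    Pi.mulSingle p (expPauli w θ) ∈ scalarGroup L σ := by
  obtain ⟨d, hd, hσ⟩ := σ.exists_sign hl
  refine ⟨Real.cos θ + Complex.I * Real.sin θ * d, fun ψ hψ => ?_⟩
  have h1 : siteOp p (hPauli w) *ᵥ ψ = (d : ℂ) • ψ := by
    conv_rhs => rw [← hψ _ hl, hσ, hOp_single, Matrix.smul_mulVec, smul_smul]
    rw [← Complex.ofReal_mul, hd, Complex.ofReal_one, one_smul]
  rw [locURep_mulSingle, siteOp_expPauli, Matrix.add_mulVec, Matrix.smul_mulVec,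
    Matrix.smul_mulVec, h1, Matrix.one_mulVec, smul_smul, add_smul]

theorem expPauli_pair_mem_scalarGroup {L : Submodule (ZMod 2) (QV P)} (σ : PauliSection L)
    {p q : P} (hpq : p ≠ q) {w w' : V} (hl : Pi.single p w + Pi.single q w' ∈ L) {d : ℝ}
    (hd : d * d = 1)
    (hσ : σ.toFun (Pi.single p w + Pi.single q w') =
      (d : ℂ) • hOp (Pi.single p w + Pi.single q w')) (θ : ℝ) :
    Pi.mulSingle p (expPauli w θ) * Pi.mulSingle q (expPauli w' (-(d * θ))) ∈
      scalarGroup L σ := by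
  refine ⟨1, fun ψ hψ => ?_⟩
  have hd' : (d : ℂ) * d = 1 := by exact_mod_cast hd
  have hA : siteOp p (hPauli w) * siteOp p (hPauli w) = 1 := by rw [← siteOp_mul, hPauli_mul_self, siteOp_one]
  have hcos : Real.cos (-(d * θ)) = Real.cos θ := by
    rcases mul_self_eq_one_iff.1 hd with rfl | rfl <;> simp
  have hsin : Real.sin (-(d * θ)) = -(d * Real.sin θ) := by
    rcases mul_self_eq_one_iff.1 hd with rfl | rfl <;> simp
  have h1 : siteOp p (hPauli w) *ᵥ (siteOp q (hPauli w') *ᵥ ψ) = (d : ℂ) • ψ := by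
    rw [Matrix.mulVec_mulVec, ← hOp_single_add_single hpq]
    conv_rhs => rw [← hψ _ hl, hσ, Matrix.smul_mulVec, smul_smul, hd', one_smul]
  have h2 : siteOp q (hPauli w') *ᵥ ψ = (d : ℂ) • (siteOp p (hPauli w) *ᵥ ψ) := by
    rw [← Matrix.mulVec_smul, ← h1, Matrix.mulVec_mulVec, hA, Matrix.one_mulVec]
  have h3 : (Real.cos θ : ℂ) * Real.cos θ + Real.sin θ * Real.sin θ = 1 := by
    exact_mod_cast (by nlinarith [Real.sin_sq_add_cos_sq θ] :
      Real.cos θ * Real.cos θ + Real.sin θ * Real.sin θ = 1)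
  rw [map_mul, locURep_mulSingle, locURep_mulSingle, siteOp_expPauli, siteOp_expPauli, hcos, hsin,
    ← Matrix.mulVec_mulVec]
  simp only [Matrix.add_mulVec, Matrix.smul_mulVec, Matrix.one_mulVec, Matrix.mulVec_add,
    Matrix.mulVec_smul]
  rw [h1, h2]
  have hI : Complex.I * Complex.I = -1 := Complex.I_mul_I
  simp only [Complex.ofReal_neg, Complex.ofReal_mul]
  generalize Real.cos θ = c at h3 ⊢
  generalize Real.sin θ = s at h3 ⊢
  match_scalars
  · linear_combination (-s * s * d * d : ℂ) * hI + (s * s : ℂ) * hd' + h3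
  · linear_combination (-Complex.I * s * c) * hd'

/-! ### Local unitaries closest to the identity modulo scalar automorphisms -/

/-- The sum of the real parts of the normalised traces: it is maximal at the identity. -/
def traceSum (g : LocU P) : ℝ :=
  ∑ p, ((g p : Matrix (Fin 2) (Fin 2) ℂ).trace / 2).re

theorem traceSum_mul_mulSingle (g : LocU P) (p : P) (x : Matrix.unitaryGroup (Fin 2) ℂ) :
    traceSum (g * Pi.mulSingle p x) - traceSum g =
      (((g p : Matrix (Fin 2) (Fin 2) ℂ) * (x : Matrix (Fin 2) (Fin 2) ℂ)).trace / 2).re -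
        ((g p : Matrix (Fin 2) (Fin 2) ℂ).trace / 2).re := by
  rw [traceSum, traceSum, ← Finset.sum_sub_distrib, Finset.sum_eq_single p]
  · simp
  · intro r _ hr
    simp [hr]
  · simp

omit [DecidableEq P] in
theorem continuous_traceSum : Continuous (traceSum : LocU P → ℝ) := by
  refine continuous_finsetSum _ fun p _ => Complex.continuous_re.comp ?_
  have h : Continuous fun g : LocU P => (g p : Matrix (Fin 2) (Fin 2) ℂ) :=
    continuous_subtype_val.comp (continuous_apply p)
  exact h.matrix_trace.div_const 2

omit [Fintype P] [DecidableEq P] in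
theorem re_half_trace_le_one (g : LocU P) (p : P) :
    ((g p : Matrix (Fin 2) (Fin 2) ℂ).trace / 2).re ≤ 1 :=
  (Complex.re_le_norm _).trans (norm_half_trace_le_one (g p).2)

theorem re_half_trace_ge (g : LocU P) (p : P) :
    traceSum g - (Fintype.card P - 1) ≤ ((g p : Matrix (Fin 2) (Fin 2) ℂ).trace / 2).re := by
  have h : ∑ r ∈ Finset.univ.erase p, ((g r : Matrix (Fin 2) (Fin 2) ℂ).trace / 2).re ≤
      ∑ r ∈ Finset.univ.erase p, (1 : ℝ) :=
    Finset.sum_le_sum fun r _ => re_half_trace_le_one g r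
  rw [Finset.sum_const, Finset.card_erase_of_mem (Finset.mem_univ p), Finset.card_univ,
    nsmul_eq_mul, mul_one, Nat.cast_sub (Fintype.card_pos_iff.2 ⟨p⟩), Nat.cast_one] at h
  rw [traceSum, ← Finset.add_sum_erase _ _ (Finset.mem_univ p)]
  linarith

/-- `g` maximises `traceSum` in its coset modulo the automorphisms acting by a scalar. -/
def IsCosetMax (L : Submodule (ZMod 2) (QV P)) (σ : PauliSection L) (g : LocU P) : Prop :=
  ∀ z ∈ scalarGroup L σ, traceSum (g * z) ≤ traceSum g

theorem IsCosetMax.im_pauliCoeff_eq_zero {L : Submodule (ZMod 2) (QV P)} {σ : PauliSection L}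
    {g : LocU P} (hg : IsCosetMax L σ g) {p : P} {w : V} (hl : Pi.single p w ∈ L) :
    (pauliCoeff w (g p)).im = 0 := by
  refine eq_zero_of_cos_sin_le (A := ((g p : Matrix (Fin 2) (Fin 2) ℂ).trace / 2).re) fun θ => ?_
  have h := hg _ (expPauli_mem_scalarGroup σ hl θ)
  have h' := traceSum_mul_mulSingle g p (expPauli w θ)
  rw [half_trace_mul_expPauli] at h'
  linarith

theorem IsCosetMax.im_pauliCoeff_pair {L : Submodule (ZMod 2) (QV P)} {σ : PauliSection L}
    {g : LocU P} (hg : IsCosetMax L σ g) {p q : P} (hpq : p ≠ q) {w w' : V}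
    (hl : Pi.single p w + Pi.single q w' ∈ L) {d : ℝ} (hd : d * d = 1)
    (hσ : σ.toFun (Pi.single p w + Pi.single q w') =
      (d : ℂ) • hOp (Pi.single p w + Pi.single q w')) :
    (pauliCoeff w (g p)).im = d * (pauliCoeff w' (g q)).im := by
  have hcos : ∀ θ, Real.cos (-(d * θ)) = Real.cos θ := by
    intro θ; rcases mul_self_eq_one_iff.1 hd with rfl | rfl <;> simp
  have hsin : ∀ θ, Real.sin (-(d * θ)) = -(d * Real.sin θ) := by
    intro θ; rcases mul_self_eq_one_iff.1 hd with rfl | rfl <;> simp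
  refine sub_eq_zero.1 (eq_zero_of_cos_sin_le
    (A := ((g p : Matrix (Fin 2) (Fin 2) ℂ).trace / 2).re +
      ((g q : Matrix (Fin 2) (Fin 2) ℂ).trace / 2).re) fun θ => ?_)
  have h := hg _ (expPauli_pair_mem_scalarGroup σ hpq hl hd hσ θ)
  rw [← mul_assoc] at h
  have h1 := traceSum_mul_mulSingle g p (expPauli w θ)
  have h2 := traceSum_mul_mulSingle (g * Pi.mulSingle p (expPauli w θ)) q
    (expPauli w' (-(d * θ)))
  rw [Pi.mul_apply, Pi.mulSingle_eq_of_ne hpq.symm, mul_one, half_trace_mul_expPauli, hcos,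
    hsin] at h2
  rw [half_trace_mul_expPauli] at h1
  linarith

/-! ### Unitary operators of real nonzero trace -/

theorem unitary_entries_of_real_trace {u : Matrix (Fin 2) (Fin 2) ℂ}
    (hu : u ∈ Matrix.unitaryGroup (Fin 2) ℂ) (him : (u.trace / 2).im = 0)
    (hre : (u.trace / 2).re ≠ 0) :
    u 1 1 = star (u 0 0) ∧ u 1 0 = -star (u 0 1) ∧ u 0 0 * star (u 0 0) + u 0 1 * star (u 0 1) = 1 := by
  have h1 : u * star u = 1 := Matrix.mem_unitaryGroup_iff.1 hu
  have hadj : u.adjugate = u.det • star u := by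
    rw [← mul_one u.adjugate, ← h1, ← Matrix.mul_assoc, Matrix.adjugate_mul, Matrix.smul_mul,
      one_mul]
  have ht : star (u.trace / 2) = u.trace / 2 := Complex.conj_eq_iff_im.2 him
  have ht0 : u.trace / 2 ≠ 0 := fun h => hre (by rw [h]; rfl)
  rw [Matrix.adjugate_fin_two, Matrix.star_eq_conjTranspose] at hadj
  have e00 : u 1 1 = u.det * star (u 0 0) := by simpa using congrFun (congrFun hadj 0) 0
  have e11 : u 0 0 = u.det * star (u 1 1) := by simpa using congrFun (congrFun hadj 1) 1
  have e10 : -u 1 0 = u.det * star (u 0 1) := by simpa using congrFun (congrFun hadj 1) 0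
  have hdet : u.det = 1 := by
    have h : u.det * (u.trace / 2) = u.trace / 2 := by
      conv_lhs => rw [← ht]
      rw [Matrix.trace_fin_two, star_div₀, star_add, star_ofNat]
      linear_combination -(e00 + e11) / 2
    exact mul_right_cancel₀ ht0 (h.trans (one_mul _).symm)
  rw [hdet, one_mul] at e00 e10
  refine ⟨e00, by rw [← e10, neg_neg], ?_⟩
  have := congrFun (congrFun h1 0) 0
  simpa [Matrix.mul_apply, Fin.sum_univ_two] using this

theorem pauliCoeff_x (u : Matrix (Fin 2) (Fin 2) ℂ) :
    pauliCoeff (0, 1) u = (u 0 1 + u 1 0) / 2 := by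
  rw [pauliCoeff, hPauli_x, Matrix.trace_fin_two, Matrix.mul_apply, Matrix.mul_apply]
  simp [sigmaX, add_comm]

theorem pauliCoeff_z (u : Matrix (Fin 2) (Fin 2) ℂ) :
    pauliCoeff (1, 0) u = (u 0 0 - u 1 1) / 2 := by
  rw [pauliCoeff, hPauli_z, Matrix.trace_fin_two, Matrix.mul_apply, Matrix.mul_apply]
  simp [sigmaZ, sub_eq_add_neg]

theorem pauliCoeff_y (u : Matrix (Fin 2) (Fin 2) ℂ) :
    pauliCoeff (1, 1) u = Complex.I * (u 1 0 - u 0 1) / 2 := by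
  rw [pauliCoeff, hPauli_y, Matrix.trace_fin_two, Matrix.mul_apply, Matrix.mul_apply]
  simp
  ring

theorem pauliCoeff_of_real_trace {u : Matrix (Fin 2) (Fin 2) ℂ}
    (hu : u ∈ Matrix.unitaryGroup (Fin 2) ℂ) (him : (u.trace / 2).im = 0)
    (hre : (u.trace / 2).re ≠ 0) {w : V} (hw : w ≠ 0) :
    (pauliCoeff w u).re = 0 ∧ (pauliCoeff w u).im ^ 2 ≤ 1 - (u.trace / 2).re ^ 2 := by
  obtain ⟨h1, h2, h3⟩ := unitary_entries_of_real_trace hu him hre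
  rw [Matrix.trace_fin_two, h1]
  generalize h6 : u 0 0 = x at *
  generalize h5 : u 0 1 = y at *
  have h4 : x.re ^ 2 + x.im ^ 2 + (y.re ^ 2 + y.im ^ 2) = 1 := by
    have := congrArg Complex.re h3
    simp at this
    linarith
  have hx : (x + star x) / 2 = (x.re : ℂ) := by apply Complex.ext <;> simp
  rw [hx, Complex.ofReal_re]
  rcases V_cases w with rfl | rfl | rfl | rfl
  · exact absurd rfl hw
  · have hy : (y + -star y) / 2 = (y.im : ℂ) * Complex.I := by apply Complex.ext <;> simp
    rw [pauliCoeff_x, h2, h5, hy]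
    simp
    nlinarith [sq_nonneg x.im, sq_nonneg y.re]
  · have hy : (x - star x) / 2 = (x.im : ℂ) * Complex.I := by apply Complex.ext <;> simp
    rw [pauliCoeff_z, h1, h6, hy]
    simp
    nlinarith [sq_nonneg y.im, sq_nonneg y.re]
  · have hy : Complex.I * (-star y - y) / 2 = ((-y.re : ℝ) : ℂ) * Complex.I := by
      apply Complex.ext <;> simp
      ring
    rw [pauliCoeff_y, h2, h5, hy]
    simp
    nlinarith [sq_nonneg x.im, sq_nonneg y.im]

theorem eq_scalar_of_pauliCoeff_eq_zero {u : Matrix (Fin 2) (Fin 2) ℂ}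
    (h : ∀ w : V, w ≠ 0 → pauliCoeff w u = 0) : u = (u.trace / 2) • (1 : Matrix _ _ ℂ) := by
  have hx := h (0, 1) (by decide)
  have hz := h (1, 0) (by decide)
  have hy := h (1, 1) (by decide)
  rw [pauliCoeff_x] at hx
  rw [pauliCoeff_z] at hz
  rw [pauliCoeff_y, mul_div_assoc] at hy
  have hy' := (mul_eq_zero.1 hy).resolve_left Complex.I_ne_zero
  ext i j
  fin_cases i <;> fin_cases j <;> simp [Matrix.trace_fin_two]
  · linear_combination hz
  · linear_combination hx - hy'
  · linear_combination hx + hy'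
  · linear_combination -hz

/-! ### Errors that are detected by the code -/

theorem siteOp_anticomm_hOp {p : P} {w : V} {m : QV P} (hw : w ≠ 0) (hm : m p ≠ 0)
    (hmw : m p ≠ w) : siteOp p (hPauli w) * hOp m = -(hOp m * siteOp p (hPauli w)) := by
  have h : (fun r => Function.update (fun _ : P => (1 : Matrix (Fin 2) (Fin 2) ℂ)) p (hPauli w) r *
      hPauli (m r)) = fun r => (if r = p then (-1 : ℂ) else 1) •
        (hPauli (m r) * Function.update (fun _ : P => (1 : Matrix (Fin 2) (Fin 2) ℂ)) p
          (hPauli w) r) := by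
    funext r
    by_cases hr : r = p
    · subst hr
      simp [hPauli_anticomm hm hw hmw]
    · simp [hr]
  rw [siteOp, hOp, locOp_mul, h, locOp_smul, locOp_mul]
  simp

/-- The sum of all elements of the stabilizer group: a multiple of the projection on the code. -/
def stabSum (L : Submodule (ZMod 2) (QV P)) (σ : PauliSection L) : MatP P :=
  ∑ l : L, σ.toFun l

theorem mul_stabSum {L : Submodule (ZMod 2) (QV P)} (σ : PauliSection L) {m : QV P}
    (hm : m ∈ L) : σ.toFun m * stabSum L σ = stabSum L σ := by
  rw [stabSum, Finset.mul_sum]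
  conv_rhs => rw [← Equiv.sum_comp (Equiv.addLeft (⟨m, hm⟩ : L))]
  exact Finset.sum_congr rfl fun l _ => (σ.mul_of_mem m hm l l.2).symm

theorem stabSum_mul {L : Submodule (ZMod 2) (QV P)} (σ : PauliSection L) {m : QV P}
    (hm : m ∈ L) : stabSum L σ * σ.toFun m = stabSum L σ := by
  rw [stabSum, Finset.sum_mul]
  conv_rhs => rw [← Equiv.sum_comp (Equiv.addRight (⟨m, hm⟩ : L))]
  exact Finset.sum_congr rfl fun l _ => (σ.mul_of_mem l l.2 m hm).symm

theorem stabSum_mulVec_mem {L : Submodule (ZMod 2) (QV P)} (σ : PauliSection L) (ψ : HP P) :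
    stabSum L σ *ᵥ ψ ∈ code L σ := by
  intro v hv
  rw [Matrix.mulVec_mulVec, mul_stabSum σ hv]

/-- If a one-qubit error is detected by the code, then the corresponding component of a local
automorphism of the code vanishes. -/
theorem trace_mul_stabSum_eq_zero {L : Submodule (ZMod 2) (QV P)} {σ : PauliSection L}
    {g : LocU P} (hg : g ∈ autGroup L σ) {p : P} {w : V} {m : QV P} (hmL : m ∈ L) (hw : w ≠ 0)
    (hm : m p ≠ 0) (hmw : m p ≠ w) :
    (siteOp p (hPauli w) * locURep g * stabSum L σ).trace = 0 := by
  obtain ⟨d, hd, hσ⟩ := σ.exists_sign hmL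
  have hfix : σ.toFun m * (locURep g * stabSum L σ) = locURep g * stabSum L σ := by
    apply Matrix.mulVec_injective
    funext ψ
    simp only [← Matrix.mulVec_mulVec]
    exact hg _ (stabSum_mulVec_mem σ ψ) m hmL
  have hanti : σ.toFun m * siteOp p (hPauli w) = -(siteOp p (hPauli w) * σ.toFun m) := by
    rw [hσ, Matrix.smul_mul, Matrix.mul_smul, siteOp_anticomm_hOp hw hm hmw, smul_neg, neg_neg]
  have h : (siteOp p (hPauli w) * locURep g * stabSum L σ).trace =
      -(siteOp p (hPauli w) * locURep g * stabSum L σ).trace := by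
    calc _ = (siteOp p (hPauli w) * locURep g * stabSum L σ * σ.toFun m).trace := by
          rw [Matrix.mul_assoc _ (stabSum L σ), stabSum_mul σ hmL]
      _ = (σ.toFun m * siteOp p (hPauli w) * (locURep g * stabSum L σ)).trace := by
          rw [Matrix.trace_mul_comm]
          simp only [Matrix.mul_assoc]
      _ = _ := by
          rw [hanti, Matrix.neg_mul, Matrix.trace_neg, Matrix.mul_assoc, hfix, Matrix.mul_assoc]
  exact self_eq_neg.1 h

theorem trace_site_mul_locURep_mul_hOp (g : LocU P) (p : P) (w : V) (l : QV P) :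
    ∃ κ : ℂ, ‖κ‖ = 1 ∧ (l p = 0 ∨ l p = w → κ = 1) ∧
      (l p ≠ 0 → w ≠ 0 → l p ≠ w → κ.re = 0) ∧
      (siteOp p (hPauli w) * locURep g * hOp l).trace = 2 ^ Fintype.card P *
        (κ * ∏ r, pauliCoeff ((l + Pi.single p w : QV P) r) (g r : Matrix (Fin 2) (Fin 2) ℂ)) := by
  obtain ⟨κ, k1, k2, k3, k4⟩ := hPauli_mul (l p) w
  refine ⟨κ, k1, k3, k4, ?_⟩
  have hκ : κ = ∏ r : P, if r = p then κ else 1 := by simp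
  have h2 : (2 : ℂ) ^ Fintype.card P = ∏ _r : P, (2 : ℂ) := by simp
  rw [siteOp, locURep_apply, hOp, locOp_mul, locOp_mul, trace_locOp]
  conv_rhs => rw [hκ, h2, ← Finset.prod_mul_distrib, ← Finset.prod_mul_distrib]
  refine Finset.prod_congr rfl fun r _ => ?_
  rw [Matrix.trace_mul_comm, ← Matrix.mul_assoc, pauliCoeff]
  by_cases hr : r = p
  · subst hr
    rw [Function.update_self, k2, Matrix.smul_mul, Matrix.trace_smul]
    simp
    ring
  · simp [hr]
    ring

/-! ### Finiteness -/

theorem norm_prod_le_sq {ι : Type} [Fintype ι] [DecidableEq ι] {f : ι → ℂ} {δ : ℝ}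
    (hf : ∀ i, ‖f i‖ ≤ 1) {i j : ι} (hij : i ≠ j) (hi : ‖f i‖ ≤ δ) (hj : ‖f j‖ ≤ δ) :
    ‖∏ k, f k‖ ≤ δ ^ 2 := by
  have hδ : 0 ≤ δ := (norm_nonneg _).trans hi
  have hj' : j ∈ Finset.univ.erase i := Finset.mem_erase.2 ⟨hij.symm, Finset.mem_univ j⟩
  rw [norm_prod, ← Finset.mul_prod_erase _ _ (Finset.mem_univ i), ← Finset.mul_prod_erase _ _ hj']
  have h : ∏ k ∈ (Finset.univ.erase i).erase j, ‖f k‖ ≤ 1 :=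
    Finset.prod_le_one (fun k _ => norm_nonneg _) fun k _ => hf k
  have h0 : 0 ≤ ∏ k ∈ (Finset.univ.erase i).erase j, ‖f k‖ :=
    Finset.prod_nonneg fun k _ => norm_nonneg _
  calc ‖f i‖ * (‖f j‖ * ∏ k ∈ (Finset.univ.erase i).erase j, ‖f k‖)
      ≤ δ * (δ * 1) := by gcongr
    _ = δ ^ 2 := by ring

omit [Fintype P] [DecidableEq P] in
theorem QV_add_self (v : QV P) : v + v = 0 := by
  funext p
  have : ∀ v : V, v + v = 0 := by decide
  exact this (v p)

theorem prod_pauliCoeff_single {g : LocU P}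
    (him : ∀ r, ((g r : Matrix (Fin 2) (Fin 2) ℂ).trace / 2).im = 0)
    {q : P} {w' : V} (h : (pauliCoeff w' (g q)).re = 0) :
    ∏ r, pauliCoeff ((Pi.single q w' : QV P) r) (g r) =
      (((pauliCoeff w' (g q)).im *
        ∏ r ∈ Finset.univ.erase q, ((g r : Matrix (Fin 2) (Fin 2) ℂ).trace / 2).re : ℝ) : ℂ) *
          Complex.I := by
  rw [← Finset.mul_prod_erase _ _ (Finset.mem_univ q), Pi.single_eq_same]
  have h1 : pauliCoeff w' (g q) = ((pauliCoeff w' (g q)).im : ℂ) * Complex.I := by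
    apply Complex.ext <;> simp [h]
  have h2 : ∏ r ∈ Finset.univ.erase q, pauliCoeff ((Pi.single q w' : QV P) r) (g r) =
      ∏ r ∈ Finset.univ.erase q,
        (((g r : Matrix (Fin 2) (Fin 2) ℂ).trace / 2).re : ℂ) := by
    refine Finset.prod_congr rfl fun r hr => ?_
    rw [Pi.single_eq_of_ne (Finset.ne_of_mem_erase hr), pauliCoeff_zero]
    apply Complex.ext
    · simp
    · rw [him r, Complex.ofReal_im]
  rw [h2]
  conv_lhs => rw [h1]
  push_cast
  ring

/-- Every component of a local unitary of maximal trace along a Pauli operator of a single qubit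
interferes constructively with the components along stabilizer-equivalent one-qubit operators. -/
theorem IsCosetMax.term_lower_bound {L : Submodule (ZMod 2) (QV P)} {σ : PauliSection L}
    {g : LocU P} (hg : IsCosetMax L σ g)
    (hpos : ∀ r, 0 < ((g r : Matrix (Fin 2) (Fin 2) ℂ).trace / 2).re)
    {δ : ℝ} (hδ : ∀ r, ∀ v : V, v ≠ 0 → ‖pauliCoeff v (g r)‖ ≤ δ) {p : P} {w : V} (hw : w ≠ 0)
    (hwL : Pi.single p w ∉ L) {l : QV P} (hl : l ∈ L) {d : ℝ} (hd : d * d = 1)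
    (hσ : σ.toFun l = (d : ℂ) • hOp l) {κ : ℂ} (hκ : ‖κ‖ = 1) (hκ1 : l p = 0 ∨ l p = w → κ = 1)
    (hκ2 : l p ≠ 0 → w ≠ 0 → l p ≠ w → κ.re = 0) :
    -(δ ^ 2 * |(pauliCoeff w (g p)).im|) ≤
      ((d : ℂ) * (κ * ∏ r, pauliCoeff ((l + Pi.single p w : QV P) r) (g r))).im *
        (pauliCoeff w (g p)).im ∧
    (l = 0 → (pauliCoeff w (g p)).im ^ 2 *
        ∏ r ∈ Finset.univ.erase p, ((g r : Matrix (Fin 2) (Fin 2) ℂ).trace / 2).re ≤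
      ((d : ℂ) * (κ * ∏ r, pauliCoeff ((l + Pi.single p w : QV P) r) (g r))).im *
        (pauliCoeff w (g p)).im) := by
  have him : ∀ r, ((g r : Matrix (Fin 2) (Fin 2) ℂ).trace / 2).im = 0 := fun r => by
    rw [← pauliCoeff_zero]
    exact hg.im_pauliCoeff_eq_zero (p := r) (by rw [Pi.single_zero]; exact L.zero_mem)
  have hre : ∀ r, ∀ v : V, v ≠ 0 → (pauliCoeff v (g r)).re = 0 := fun r v hv =>
    (pauliCoeff_of_real_trace (g r).2 (him r) (hpos r).ne' hv).1
  have hprod : ∀ q : P,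
      0 < ∏ r ∈ Finset.univ.erase q, ((g r : Matrix (Fin 2) (Fin 2) ℂ).trace / 2).re :=
    fun q => Finset.prod_pos fun r _ => hpos r
  have hneg : -(δ ^ 2 * |(pauliCoeff w (g p)).im|) ≤ 0 := by
    have := mul_nonneg (sq_nonneg δ) (abs_nonneg (pauliCoeff w (g p)).im)
    linarith
  by_cases hl0 : l = 0
  · subst hl0
    have hd1 : (d : ℂ) = 1 := by
      rw [σ.map_zero, hOp, show (fun p => hPauli ((0 : QV P) p)) = fun _ => 1 from
        funext fun _ => hPauli_zero, locOp_one] at hσ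
      have := congrFun (congrFun hσ (fun _ => 0)) (fun _ => 0)
      simpa using this.symm
    have h : ((d : ℂ) * (κ * ∏ r, pauliCoeff ((0 + Pi.single p w : QV P) r) (g r))).im *
        (pauliCoeff w (g p)).im = (pauliCoeff w (g p)).im ^ 2 *
        ∏ r ∈ Finset.univ.erase p, ((g r : Matrix (Fin 2) (Fin 2) ℂ).trace / 2).re := by
      rw [hd1, hκ1 (Or.inl rfl), zero_add, prod_pauliCoeff_single him (hre p w hw), one_mul,
        one_mul, Complex.im_ofReal_mul, Complex.I_im]
      ring
    rw [h]
    exact ⟨hneg.trans (mul_nonneg (sq_nonneg _) (hprod p).le), fun _ => le_rfl⟩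
  refine ⟨?_, fun h => absurd h hl0⟩
  have hne : l + Pi.single p w ≠ 0 := fun h => hwL <| by
    have : Pi.single p w = l := by
      rw [← add_zero l, ← QV_add_self (Pi.single p w), ← add_assoc, h, zero_add]
    rwa [this]
  obtain ⟨q, hq⟩ := Function.ne_iff.1 hne
  by_cases hq' : ∃ q', q' ≠ q ∧ (l + Pi.single p w : QV P) q' ≠ 0
  · obtain ⟨q', hqq', hq'⟩ := hq'
    have hb : ‖∏ r, pauliCoeff ((l + Pi.single p w : QV P) r) (g r)‖ ≤ δ ^ 2 :=
      norm_prod_le_sq (fun r => norm_pauliCoeff_le_one _ (g r).2) hqq' (hδ _ _ hq') (hδ _ _ hq)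
    have hd1 : |d| = 1 := by
      rcases mul_self_eq_one_iff.1 hd with rfl | rfl <;> simp
    have hb' : |((d : ℂ) * (κ * ∏ r, pauliCoeff ((l + Pi.single p w : QV P) r) (g r))).im| ≤
        δ ^ 2 := by
      refine (Complex.abs_im_le_norm _).trans ?_
      rwa [norm_mul, norm_mul, hκ, Complex.norm_real, Real.norm_eq_abs, hd1, one_mul, one_mul]
    refine neg_le_of_abs_le ?_
    rw [abs_mul]
    exact mul_le_mul_of_nonneg_right hb' (abs_nonneg _)
  · push Not at hq'
    set w' := (l + Pi.single p w : QV P) q with hw'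
    have hsingle : l + Pi.single p w = Pi.single q w' := by
      funext r
      by_cases hr : r = q
      · subst hr; simp [hw']
      · rw [hq' r hr, Pi.single_eq_of_ne hr]
    have hl_eq : l = Pi.single p w + Pi.single q w' := by
      rw [← hsingle, add_comm l, ← add_assoc, QV_add_self, zero_add]
    have hw'0 : w' ≠ 0 := hq
    rw [hsingle, prod_pauliCoeff_single him (hre q w' hw'0)]
    refine hneg.trans ?_
    by_cases hpq : p = q
    · subst hpq
      rw [← Pi.single_add] at hl_eq
      have hlp : l p = w + w' := by rw [hl_eq, Pi.single_eq_same]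
      have hk : κ.re = 0 := by
        refine hκ2 (fun h => hl0 ?_) hw (fun h => hw'0 ?_)
        · rw [hl_eq, ← hlp, h, Pi.single_zero]
        · rwa [hlp, add_eq_left] at h
      rw [Complex.im_ofReal_mul, mul_left_comm, Complex.im_ofReal_mul, Complex.mul_I_im, hk]
      simp
    · have hlp : l p = w := by rw [hl_eq]; simp [hpq]
      rw [hl_eq] at hl hσ
      have hb := hg.im_pauliCoeff_pair hpq hl hd hσ
      rw [hκ1 (Or.inr hlp), one_mul, Complex.im_ofReal_mul, Complex.im_ofReal_mul, Complex.I_im,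
        mul_one, ← mul_assoc, ← hb, mul_right_comm]
      exact mul_nonneg (mul_self_nonneg _) (hprod q).le

/-- A quadratic bound on the components of a local automorphism of maximal trace along detected
one-qubit errors. -/
theorem IsCosetMax.quadratic_bound {L : Submodule (ZMod 2) (QV P)} {σ : PauliSection L}
    {g : LocU P} (hg : IsCosetMax L σ g) (haut : g ∈ autGroup L σ)
    (hpos : ∀ r, 0 < ((g r : Matrix (Fin 2) (Fin 2) ℂ).trace / 2).re)
    {δ : ℝ} (hδ : ∀ r, ∀ v : V, v ≠ 0 → ‖pauliCoeff v (g r)‖ ≤ δ) {p : P} {w : V} (hw : w ≠ 0)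
    (hwL : Pi.single p w ∉ L) {m : QV P} (hmL : m ∈ L) (hm : m p ≠ 0) (hmw : m p ≠ w) :
    (pauliCoeff w (g p)).im ^ 2 *
        ∏ r ∈ Finset.univ.erase p, ((g r : Matrix (Fin 2) (Fin 2) ℂ).trace / 2).re ≤
      Fintype.card L * (δ ^ 2 * |(pauliCoeff w (g p)).im|) := by
  choose d hd hσ using fun l : L => σ.exists_sign l.2
  choose κ hκ hκ1 hκ2 htr using fun l : L => trace_site_mul_locURep_mul_hOp g p w l
  set T : L → ℂ := fun l =>
    (d l : ℂ) * (κ l * ∏ r, pauliCoeff (((l : QV P) + Pi.single p w : QV P) r) (g r))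
  have hsum : ∑ l, T l = 0 := by
    have h := trace_mul_stabSum_eq_zero haut hmL hw hm hmw
    rw [stabSum, Finset.mul_sum, Matrix.trace_sum] at h
    simp only [hσ, Matrix.mul_smul, Matrix.trace_smul, htr, smul_eq_mul] at h
    rw [Finset.sum_congr rfl fun l _ => mul_left_comm _ _ _, ← Finset.mul_sum] at h
    refine (mul_eq_zero.1 h).resolve_left ?_
    exact pow_ne_zero _ two_ne_zero
  have hb := fun l : L => hg.term_lower_bound hpos hδ hw hwL l.2 (hd l) (hσ l) (hκ l) (hκ1 l)
    (hκ2 l)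
  set b := (pauliCoeff w (g p)).im
  have h1 : ∑ l, ((T l).im * b + δ ^ 2 * |b|) = Fintype.card L * (δ ^ 2 * |b|) := by
    rw [Finset.sum_add_distrib, ← Finset.sum_mul, ← Complex.im_sum, hsum]
    simp
  rw [← h1]
  have h0 : (T 0).im * b + δ ^ 2 * |b| ≤ ∑ l, ((T l).im * b + δ ^ 2 * |b|) :=
    Finset.single_le_sum (f := fun l => (T l).im * b + δ ^ 2 * |b|)
      (fun l _ => by linarith [(hb l).1]) (Finset.mem_univ 0)
  have h2 := (hb 0).2 rfl
  have h3 := mul_nonneg (sq_nonneg δ) (abs_nonneg b)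
  linarith

omit [Fintype P] in
/-- If every nontrivial qubit is protected, then a one-qubit Pauli operator is detected by the
code or belongs to the stabilizer. -/
theorem exists_detecting {L : Submodule (ZMod 2) (QV P)}
    (hprot : ∀ p : P, ¬ TrivialQubit L p → IsProtected L p) {p : P} {w : V}
    (hw : w ≠ 0) (hwL : Pi.single p w ∉ L) : ∃ m ∈ L, m p ≠ 0 ∧ m p ≠ w := by
  by_cases ht : TrivialQubit L p
  · obtain ⟨-, v, hv, hv0, hsupp⟩ := ht
    have hvs : v = Pi.single p (v p) := by
      funext r
      by_cases hr : r = p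
      · subst hr; simp
      · rw [Pi.single_eq_of_ne hr]
        by_contra h
        exact hr (hsupp h)
    refine ⟨v, hv, fun h => hv0 ?_, fun h => hwL ?_⟩
    · rw [hvs, h, Pi.single_zero]
    · rwa [← h, ← hvs]
  · have h : ∀ w : V, w ≠ 0 → ∃ w' : V, w' ≠ 0 ∧ w' ≠ w := by decide
    obtain ⟨w', h0, h1⟩ := h w hw
    obtain ⟨m, hm, rfl⟩ := hprot p ht w'
    exact ⟨m, hm, h0, h1⟩

/-- Local automorphisms of maximal trace which are close to the identity are scalars. -/
theorem IsCosetMax.mem_scalarGroup {L : Submodule (ZMod 2) (QV P)} {σ : PauliSection L}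
    (hprot : ∀ p : P, ¬ TrivialQubit L p → IsProtected L p)
    {g : LocU P} (hg : IsCosetMax L σ g) (haut : g ∈ autGroup L σ)
    (hnear : ∀ r, 1 - 1 / (4 * (Fintype.card L : ℝ) ^ 2 * 4 ^ Fintype.card P) ≤
      ((g r : Matrix (Fin 2) (Fin 2) ℂ).trace / 2).re) : g ∈ scalarGroup L σ := by
  set N : ℝ := (Fintype.card L : ℝ)
  have hN1 : 1 ≤ N := Nat.one_le_cast.2 Fintype.card_pos
  have h4 : (1 : ℝ) ≤ 4 ^ Fintype.card P := one_le_pow₀ (by norm_num)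
  have hden : 4 ≤ 4 * N ^ 2 * 4 ^ Fintype.card P := by nlinarith
  set ε := 1 / (4 * N ^ 2 * 4 ^ Fintype.card P) with hε
  have hε0 : 0 < ε := by positivity
  have hε4 : ε ≤ 1 / 4 := one_div_le_one_div_of_le (by norm_num) hden
  have hhalf : ∀ r, 1 / 2 ≤ ((g r : Matrix (Fin 2) (Fin 2) ℂ).trace / 2).re := fun r => by
    linarith [hnear r]
  have hpos : ∀ r, 0 < ((g r : Matrix (Fin 2) (Fin 2) ℂ).trace / 2).re := fun r => by
    linarith [hhalf r]
  have him : ∀ r, ((g r : Matrix (Fin 2) (Fin 2) ℂ).trace / 2).im = 0 := fun r => by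
    rw [← pauliCoeff_zero]
    exact hg.im_pauliCoeff_eq_zero (p := r) (by rw [Pi.single_zero]; exact L.zero_mem)
  have hstruct : ∀ r, ∀ v : V, v ≠ 0 → _ := fun r v hv =>
    pauliCoeff_of_real_trace (g r).2 (him r) (hpos r).ne' hv
  have hnorm : ∀ r, ∀ v : V, v ≠ 0 → ‖pauliCoeff v (g r)‖ = |(pauliCoeff v (g r)).im| :=
    fun r v hv => (Complex.abs_im_eq_norm.2 (hstruct r v hv).1).symm
  have hall : ∀ r, ∀ v : V, v ≠ 0 → pauliCoeff v (g r) = 0 := by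
    by_contra hcon
    push Not at hcon
    obtain ⟨r₀, v₀, hv₀, hne₀⟩ := hcon
    obtain ⟨⟨p, w, hw⟩, -, hmax⟩ := Finset.exists_max_image
      (Finset.univ : Finset (P × {v : V // v ≠ 0}))
      (fun x => ‖pauliCoeff x.2.1 (g x.1)‖) ⟨(r₀, ⟨v₀, hv₀⟩), Finset.mem_univ _⟩
    have hδ : ∀ r, ∀ v : V, v ≠ 0 → ‖pauliCoeff v (g r)‖ ≤ ‖pauliCoeff w (g p)‖ :=
      fun r v hv => hmax (r, ⟨v, hv⟩) (Finset.mem_univ _)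
    have hδ0 : 0 < ‖pauliCoeff w (g p)‖ := (norm_pos_iff.2 hne₀).trans_le (hδ r₀ v₀ hv₀)
    have hwL : Pi.single p w ∉ L := fun h => by
      rw [hnorm p w hw, hg.im_pauliCoeff_eq_zero h, abs_zero] at hδ0
      exact lt_irrefl _ hδ0
    obtain ⟨m, hmL, hm, hmw⟩ := exists_detecting hprot hw hwL
    have hq := hg.quadratic_bound haut hpos hδ hw hwL hmL hm hmw
    have hb := (hstruct p w hw).2
    rw [hnorm p w hw] at hq hδ0
    set b := (pauliCoeff w (g p)).im
    rw [← sq_abs b] at hq hb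
    set A := ∏ r ∈ Finset.univ.erase p, ((g r : Matrix (Fin 2) (Fin 2) ℂ).trace / 2).re
    have hA : (1 / 2 : ℝ) ^ Fintype.card P ≤ A := by
      calc (1 / 2 : ℝ) ^ Fintype.card P ≤ (1 / 2) ^ (Finset.univ.erase p).card :=
            pow_le_pow_of_le_one (by norm_num) (by norm_num) (Finset.card_le_univ _)
        _ = ∏ _r ∈ Finset.univ.erase p, (1 / 2 : ℝ) := by rw [Finset.prod_const]
        _ ≤ A := Finset.prod_le_prod (fun _ _ => by norm_num) fun r _ => hhalf r
    have hA' : (1 / 2 : ℝ) ^ Fintype.card P ≤ N * |b| := by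
      refine hA.trans (le_of_mul_le_mul_left ?_ (pow_pos hδ0 2))
      linarith
    have hsq : ((1 / 2 : ℝ) ^ Fintype.card P) ^ 2 ≤ (N * |b|) ^ 2 :=
      pow_le_pow_left₀ (by positivity) hA' 2
    have hb2 : |b| ^ 2 ≤ 2 * ε := by nlinarith [hnear p]
    have hpow : ((1 / 2 : ℝ) ^ Fintype.card P) ^ 2 = 1 / 4 ^ Fintype.card P := by
      rw [← pow_mul, mul_comm, pow_mul, div_pow, div_pow]
      norm_num
    have hεN : N ^ 2 * (2 * ε) = 1 / 4 ^ Fintype.card P / 2 := by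
      rw [hε]
      field_simp
      norm_num
    have h5 : (N * |b|) ^ 2 ≤ N ^ 2 * (2 * ε) := by
      rw [mul_pow]
      exact mul_le_mul_of_nonneg_left hb2 (sq_nonneg N)
    have h6 : (0 : ℝ) < 1 / 4 ^ Fintype.card P := by positivity
    linarith
  refine ⟨∏ r, ((g r : Matrix (Fin 2) (Fin 2) ℂ).trace / 2), fun ψ _ => ?_⟩
  rw [locURep_apply, show (fun r => (g r : Matrix (Fin 2) (Fin 2) ℂ)) = fun r =>
    ((g r : Matrix (Fin 2) (Fin 2) ℂ).trace / 2) • (1 : Matrix (Fin 2) (Fin 2) ℂ) from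
    funext fun r => eq_scalar_of_pauliCoeff_eq_zero (hall r), locOp_smul, locOp_one,
    Matrix.smul_mulVec, Matrix.one_mulVec]

theorem finite_autGroup_quotient {L : Submodule (ZMod 2) (QV P)} (σ : PauliSection L)
    (hprot : ∀ p : P, ¬ TrivialQubit L p → IsProtected L p) :
    Finite (autGroup L σ ⧸ (scalarGroup L σ).subgroupOf (autGroup L σ)) := by
  have : CompactSpace (Matrix.unitaryGroup (Fin 2) ℂ) := compactSpace_unitaryGroup (Fin 2)
  have : CompactSpace (autGroup L σ) :=
    isCompact_iff_compactSpace.1 (isClosed_autGroup L σ).isCompact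
  refine Subgroup.quotient_finite_of_isOpen _ ?_
  set ε : ℝ := 1 / (4 * (Fintype.card L : ℝ) ^ 2 * 4 ^ Fintype.card P)
  have hε0 : 0 < ε := by
    have : (0 : ℝ) < Fintype.card L := by exact_mod_cast Fintype.card_pos
    positivity
  refine Subgroup.isOpen_of_mem_nhds _ (g := 1) ?_
  have hopen : IsOpen {g : autGroup L σ | Fintype.card P - ε < traceSum (g : LocU P)} :=
    isOpen_lt continuous_const (continuous_traceSum.comp continuous_subtype_val)
  refine Filter.mem_of_superset (hopen.mem_nhds ?_) ?_
  · have h1 : traceSum ((1 : autGroup L σ) : LocU P) = Fintype.card P := by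
      simp [traceSum]
    rw [Set.mem_ofPred_eq, h1]
    linarith
  · intro g hg
    rw [Set.mem_ofPred_eq] at hg
    have hcont : Continuous fun z : LocU P => traceSum ((g : LocU P) * z) :=
      continuous_traceSum.comp (continuous_const.mul continuous_id)
    obtain ⟨z, hz, hzmax⟩ := (isClosed_scalarGroup L σ).isCompact.exists_isMaxOn
      ⟨1, (scalarGroup L σ).one_mem⟩ hcont.continuousOn
    have hmax : IsCosetMax L σ (g * z) := fun z' hz' => by
      rw [mul_assoc]
      exact hzmax ((scalarGroup L σ).mul_mem hz hz')
    have hge : traceSum (g : LocU P) ≤ traceSum ((g : LocU P) * z) := by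
      simpa using hzmax (scalarGroup L σ).one_mem
    have hmem : (g : LocU P) * z ∈ scalarGroup L σ := by
      refine hmax.mem_scalarGroup hprot
        ((autGroup L σ).mul_mem g.2 (scalarGroup_le_autGroup L σ hz)) fun r => ?_
      linarith [re_half_trace_ge ((g : LocU P) * z) r]
    change (g : LocU P) ∈ scalarGroup L σ
    have := (scalarGroup L σ).mul_mem hmem ((scalarGroup L σ).inv_mem hz)
    rwa [mul_inv_cancel_right] at this

/-- **Corollary (finiteness).** Let `L ⊆ V^P` be an isotropic subspace without zero
factors. If every nontrivial qubit of `P` is protected then the group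
`Ā(L) = A(L)/Z(L)` is finite (it has a finite set of coset representatives modulo
`Z(L)`). -/
theorem quotient_finite {P : Type} [Fintype P] [DecidableEq P]
    (L : Submodule (ZMod 2) (QV P)) (hL : Isotropic L)
    (hzero : ¬ HasZeroFactor L)
    (hprot : ∀ p : P, ¬ TrivialQubit L p → IsProtected L p)
    (σ : PauliSection L) :
    ∃ F : Finset (P → Rot), ↑F ⊆ autSet L σ ∧
      ∀ g ∈ autSet L σ, ∃ h ∈ F, ∃ z ∈ zSet L σ, g = h * z := by
  have := finite_autGroup_quotient σ hprot
  let rot : LocU P → P → Rot := fun g p => adjRot (g p : Matrix (Fin 2) (Fin 2) ℂ)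
  let Q := autGroup L σ ⧸ (scalarGroup L σ).subgroupOf (autGroup L σ)
  refine ⟨(Set.finite_range fun x : Q => rot (Quotient.out x : autGroup L σ)).toFinset, ?_, ?_⟩
  · rw [Set.Finite.coe_toFinset]
    rintro _ ⟨x, rfl⟩
    exact ⟨fun p => ((Quotient.out x : autGroup L σ) : LocU P) p,
      fun p => (((Quotient.out x : autGroup L σ) : LocU P) p).2, fun p => rfl,
      (Quotient.out x : autGroup L σ).2⟩
  · rintro _ ⟨u, hu, hug, hcode⟩
    let g : autGroup L σ := ⟨fun p => ⟨u p, hu p⟩, hcode⟩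
    let h : autGroup L σ := Quotient.out (QuotientGroup.mk g : Q)
    have hz : h⁻¹ * g ∈ (scalarGroup L σ).subgroupOf (autGroup L σ) :=
      QuotientGroup.eq.1 (Quotient.out_eq (QuotientGroup.mk g : Q))
    obtain ⟨c, hc⟩ := Subgroup.mem_subgroupOf.1 hz
    refine ⟨rot h, by simp [h], rot ((h⁻¹ * g : autGroup L σ) : LocU P), ?_, ?_⟩
    · exact ⟨fun p => ((h⁻¹ * g : autGroup L σ) : LocU P) p,
        fun p => (((h⁻¹ * g : autGroup L σ) : LocU P) p).2, fun p => rfl, c, hc⟩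
    · funext p
      have hmul : (g : LocU P) p = (h : LocU P) p * ((h⁻¹ * g : autGroup L σ) : LocU P) p := by
        rw [← Pi.mul_apply, ← Subgroup.coe_mul, mul_inv_cancel_left]
      rw [← hug p, Pi.mul_apply]
      change adjRot ((g : LocU P) p : Matrix (Fin 2) (Fin 2) ℂ) = _
      rw [hmul]
      exact adjRot_mul (Subtype.prop _)

end Stab
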